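/- Let M be a nonempty set of POVM effects on ℂ^d, let ρ and σ be normalized quantum states, and let η ∈ (0,1]. Define β_M(ρ,σ) := sup { |tr(Q(ρ−σ))| : Q ∈ M }. (1) If β_M(ρ,σ) < η, then D_M^η(ρ‖σ) ≤ −log( 1 − β_M(ρ,σ)/η ). (2) Let δ ≥ 0, let |ψ⟩ be a unit vector in ℂ^d with ψ := |ψ⟩⟨ψ|, and let π := I/d. If β_M(ψ,π) < 1 − 1/d − δ and η > 1 − 1/d − δ, then H_M^η(ψ) > log(d) − log( 1/(1−c) ), where c := (1 − 1/d − δ)/η ∈ (0,1). -/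

import Mathlib

open Matrix
open scoped ComplexOrder

noncomputable section

/-- A POVM effect on `ℂ^d`: `0 ≤ Q ≤ I` in the Loewner order. -/
def IsEffect {d : ℕ} (Q : Matrix (Fin d) (Fin d) ℂ) : Prop :=
  Q.PosSemidef ∧ (1 - Q).PosSemidef

/-- Real part of the trace. -/
def trRe {d : ℕ} (A : Matrix (Fin d) (Fin d) ℂ) : ℝ := (A.trace).re

/-- Complexity relative entropy `D_M^η(ρ‖Γ) := −log( inf { tr(QΓ)/tr(Qρ) : Q ∈ M, tr(Qρ) ≥ η } )`,
valued in extended reals; the infimum over the empty set is `∞`, so `D = −∞` in that case. -/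
def Dc {d : ℕ} (M : Set (Matrix (Fin d) (Fin d) ℂ))
    (ρ Γ : Matrix (Fin d) (Fin d) ℂ) (η : ℝ) : EReal :=
  - ENNReal.log (⨅ Q ∈ {Q | Q ∈ M ∧ η ≤ trRe (Q * ρ)},
      ENNReal.ofReal (trRe (Q * Γ) / trRe (Q * ρ)))

/-- Complexity entropy `H_M^η(ρ) := −D_M^η(ρ‖I)`. -/
def Hc {d : ℕ} (M : Set (Matrix (Fin d) (Fin d) ℂ))
    (ρ : Matrix (Fin d) (Fin d) ℂ) (η : ℝ) : EReal :=
  - Dc M ρ 1 η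

/-- `β_M(ρ,σ) := sup { |tr(Q(ρ−σ))| : Q ∈ M }`. -/
def betaM {d : ℕ} (M : Set (Matrix (Fin d) (Fin d) ℂ))
    (ρ σ : Matrix (Fin d) (Fin d) ℂ) : ℝ :=
  sSup {x : ℝ | ∃ Q ∈ M, x = |trRe (Q * (ρ - σ))|}

/-- The trace of a product of two positive-semidefinite matrices is nonnegative. -/
lemma trRe_mul_nonneg {d : ℕ} {A B : Matrix (Fin d) (Fin d) ℂ}
    (hA : A.PosSemidef) (hB : B.PosSemidef) : 0 ≤ trRe (A * B) := by
  open scoped MatrixOrder in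
  obtain ⟨X, rfl⟩ := CStarAlgebra.nonneg_iff_eq_star_mul_self.mp hA.nonneg
  have h := (hB.mul_mul_conjTranspose_same X).trace_nonneg
  rw [Matrix.mul_assoc, Matrix.trace_mul_comm, Matrix.mul_assoc, Matrix.trace_mul_comm] at h
  exact (Complex.nonneg_iff.mp h).1

lemma trRe_mul_sub {d : ℕ} (Q A B : Matrix (Fin d) (Fin d) ℂ) :
    trRe (Q * (A - B)) = trRe (Q * A) - trRe (Q * B) := by
  simp [trRe, mul_sub]

lemma IsEffect.trRe_mul_le_one {d : ℕ} {Q ρ : Matrix (Fin d) (Fin d) ℂ} (hQ : IsEffect Q)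
    (hρ : ρ.PosSemidef) (hρ1 : ρ.trace = 1) : trRe (Q * ρ) ≤ 1 := by
  have h := trRe_mul_nonneg hQ.2 hρ
  simp only [trRe, sub_mul, one_mul, trace_sub, hρ1, Complex.sub_re, Complex.one_re] at h ⊢
  linarith

lemma abs_trRe_le_betaM {d : ℕ} {M : Set (Matrix (Fin d) (Fin d) ℂ)}
    (hM : ∀ Q ∈ M, IsEffect Q) {ρ σ : Matrix (Fin d) (Fin d) ℂ}
    (hρ : ρ.PosSemidef) (hρ1 : ρ.trace = 1) (hσ : σ.PosSemidef) (hσ1 : σ.trace = 1)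
    {Q : Matrix (Fin d) (Fin d) ℂ} (hQ : Q ∈ M) :
    |trRe (Q * (ρ - σ))| ≤ betaM M ρ σ := by
  refine le_csSup ⟨1, ?_⟩ ⟨Q, hQ, rfl⟩
  rintro _ ⟨R, hR, rfl⟩
  have h₁ := trRe_mul_nonneg (hM R hR).1 hρ
  have h₂ := trRe_mul_nonneg (hM R hR).1 hσ
  have h₃ := (hM R hR).trRe_mul_le_one hρ hρ1
  have h₄ := (hM R hR).trRe_mul_le_one hσ hσ1
  rw [trRe_mul_sub, abs_le]
  constructor <;> linarith

lemma betaM_nonneg {d : ℕ} (M : Set (Matrix (Fin d) (Fin d) ℂ))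
    (ρ σ : Matrix (Fin d) (Fin d) ℂ) : 0 ≤ betaM M ρ σ := by
  refine Real.sSup_nonneg ?_
  rintro _ ⟨Q, -, rfl⟩
  exact abs_nonneg _

/-- Every effect feasible for the hypothesis test at level `η` has success ratio at least
`1 - β_M(ρ,σ)/η`. -/
lemma one_sub_betaM_div_le {d : ℕ} {M : Set (Matrix (Fin d) (Fin d) ℂ)}
    (hM : ∀ Q ∈ M, IsEffect Q) {ρ σ : Matrix (Fin d) (Fin d) ℂ}
    (hρ : ρ.PosSemidef) (hρ1 : ρ.trace = 1) (hσ : σ.PosSemidef) (hσ1 : σ.trace = 1)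
    {η : ℝ} (hη : 0 < η) {Q : Matrix (Fin d) (Fin d) ℂ} (hQ : Q ∈ M)
    (hQη : η ≤ trRe (Q * ρ)) :
    1 - betaM M ρ σ / η ≤ trRe (Q * σ) / trRe (Q * ρ) := by
  have hpos : 0 < trRe (Q * ρ) := hη.trans_le hQη
  have h := (le_abs_self _).trans (abs_trRe_le_betaM hM hρ hρ1 hσ hσ1 hQ)
  rw [trRe_mul_sub] at h
  have h₁ : betaM M ρ σ / trRe (Q * ρ) ≤ betaM M ρ σ / η :=
    div_le_div_of_nonneg_left (betaM_nonneg M ρ σ) hη hQη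
  have h₂ : 1 - betaM M ρ σ / trRe (Q * ρ) ≤ trRe (Q * σ) / trRe (Q * ρ) := by
    rw [one_sub_div hpos.ne']
    gcongr
    linarith
  linarith

/-- A positive lower bound on the ratios of all feasible effects bounds `D_M^η` from above. -/
lemma Dc_le_neg_log {d : ℕ} {M : Set (Matrix (Fin d) (Fin d) ℂ)}
    {ρ Γ : Matrix (Fin d) (Fin d) ℂ} {η x : ℝ} (hx : 0 < x)
    (h : ∀ Q ∈ M, η ≤ trRe (Q * ρ) → x ≤ trRe (Q * Γ) / trRe (Q * ρ)) :
    Dc M ρ Γ η ≤ ((-Real.log x : ℝ) : EReal) := by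
  rw [Dc, EReal.coe_neg, EReal.neg_le_neg_iff, ← ENNReal.log_ofReal_of_pos hx]
  exact ENNReal.log_le_log (le_iInf₂ fun Q hQ => ENNReal.ofReal_le_ofReal (h Q hQ.1 hQ.2))

/-- Bounds on the complexity (relative) entropy via the distinguishability
measure `β_M`; in particular, a complexity-entropy lower bound related to strong complexity. -/
theorem stmt17 {d : ℕ} (M : Set (Matrix (Fin d) (Fin d) ℂ))
    (hM : ∀ Q ∈ M, IsEffect Q) (hMne : M.Nonempty)
    (η : ℝ) (hη : η ∈ Set.Ioc (0:ℝ) 1) :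
    (∀ ρ σ : Matrix (Fin d) (Fin d) ℂ,
      ρ.PosSemidef → ρ.trace = 1 → σ.PosSemidef → σ.trace = 1 →
      betaM M ρ σ < η →
      Dc M ρ σ η ≤ ((-Real.log (1 - betaM M ρ σ / η) : ℝ) : EReal)) ∧
    (∀ δ : ℝ, 0 ≤ δ → ∀ ψ : Fin d → ℂ, (∑ i, Complex.normSq (ψ i)) = 1 →
      betaM M (Matrix.vecMulVec ψ (star ψ)) (((d : ℂ))⁻¹ • 1) < 1 - 1 / d - δ →
      1 - 1 / d - δ < η →
      (1 - 1 / d - δ) / η ∈ Set.Ioo (0:ℝ) 1 ∧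
      ((Real.log d - Real.log (1 / (1 - (1 - 1 / d - δ) / η)) : ℝ) : EReal) <
        Hc M (Matrix.vecMulVec ψ (star ψ)) η) := by
  obtain ⟨hη0, -⟩ := hη
  refine ⟨fun ρ σ hρ hρ1 hσ hσ1 hβ => ?_, fun δ _ ψ hψ hβ hη' => ?_⟩
  · refine Dc_le_neg_log ?_ fun Q hQ hQη => one_sub_betaM_div_le hM hρ hρ1 hσ hσ1 hη0 hQ hQη
    rwa [sub_pos, div_lt_one hη0]
  · have hd : 0 < d := by
      rcases Nat.eq_zero_or_pos d with rfl | h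
      · simp at hψ
      · exact h
    have hdR : (0 : ℝ) < d := Nat.cast_pos.mpr hd
    have hdC : (d : ℂ) ≠ 0 := Nat.cast_ne_zero.mpr hd.ne'
    have hρ := posSemidef_vecMulVec_self_star ψ
    have hρ1 : (vecMulVec ψ (star ψ)).trace = 1 := by
      rw [trace_vecMulVec, dotProduct, ← Complex.ofReal_one, ← hψ, Complex.ofReal_sum]
      exact Finset.sum_congr rfl fun i _ => Complex.mul_conj _
    have hπ : (((d : ℂ))⁻¹ • (1 : Matrix (Fin d) (Fin d) ℂ)).PosSemidef :=
      PosSemidef.one.smul (by positivity)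
    have hπ1 : (((d : ℂ))⁻¹ • (1 : Matrix (Fin d) (Fin d) ℂ)).trace = 1 := by
      simp [trace_smul, hdC]
    have htr (Q : Matrix (Fin d) (Fin d) ℂ) :
        trRe (Q * 1) = d * trRe (Q * (((d : ℂ))⁻¹ • 1)) := by
      have h : (d : ℂ) * (Q * (((d : ℂ))⁻¹ • 1)).trace = (Q * 1).trace := by
        simp [hdC]
      rw [trRe, trRe, ← h, ← Complex.ofReal_natCast, Complex.re_ofReal_mul]
    have hβ0 := betaM_nonneg M (vecMulVec ψ (star ψ)) (((d : ℂ))⁻¹ • 1)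
    set β := betaM M (vecMulVec ψ (star ψ)) (((d : ℂ))⁻¹ • 1) with hβ_def
    set c := (1 - 1 / (d : ℝ) - δ) / η with hc
    have hc0 : 0 < c := div_pos (hβ0.trans_lt hβ) hη0
    have hc1 : c < 1 := (div_lt_one hη0).mpr hη'
    have hβc : β / η < c := div_lt_div_of_pos_right hβ hη0
    refine ⟨⟨hc0, hc1⟩, ?_⟩
    have hx : 0 < d * (1 - β / η) := mul_pos hdR (by linarith)
    have hD : Dc M (vecMulVec ψ (star ψ)) 1 η ≤ ((-Real.log (d * (1 - β / η)) : ℝ) : EReal) := by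
      refine Dc_le_neg_log hx fun Q hQ hQη => ?_
      rw [htr, mul_div_assoc]
      exact mul_le_mul_of_nonneg_left (one_sub_betaM_div_le hM hρ hρ1 hπ hπ1 hη0 hQ hQη) hdR.le
    rw [EReal.coe_neg] at hD
    refine lt_of_lt_of_le ?_ (EReal.le_neg_of_le_neg hD)
    rw [EReal.coe_lt_coe_iff, one_div, Real.log_inv, sub_neg_eq_add,
      ← Real.log_mul hdR.ne' (by linarith)]
    refine Real.log_lt_log (mul_pos hdR (by linarith)) ?_
    gcongr


end
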